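/- arXiv:1906.05654 — 2 statements merged into one kernel-verified Lean document; each statement's English description precedes it below -/
import Mathlib

section
/- Let P be a left cancellative monoid and let φ : Set P → ℝ satisfy the ∨-condition. Let n ≥ 1, let p₁,q₁,…,pₙ,qₙ ∈ P, and let g : Set P → Set P be the associated chain map. Then for all X, Y ∈ J(P) with X ∪ Y ∈ J(P), one has φ(g(X ∪ Y)) = φ(g(X)) + φ(g(Y)) − φ(g(X ∩ Y)). -/
open Set

/-- Image of `X` under left multiplication by `p`: `pX = {p*x : x ∈ X}`. -/
def imgMul {P : Type*} [Monoid P] (p : P) (X : Set P) : Set P :=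
  (fun x => p * x) '' X

/-- Preimage of `X` under left multiplication by `q`: `q⁻¹X = {r : q*r ∈ X}`. -/
def preMul {P : Type*} [Monoid P] (q : P) (X : Set P) : Set P :=
  (fun x => q * x) ⁻¹' X

/-- The constructible right ideals
`J(P) = {p₁⁻¹q₁⋯pₙ⁻¹qₙP : n ≥ 1, pᵢ,qᵢ ∈ P} ∪ {∅}`. -/
def JP (P : Type*) [Monoid P] : Set (Set P) :=
  {X | X = ∅ ∨ ∃ l : List (P × P), l ≠ [] ∧
    X = l.foldr (fun pq Y => preMul pq.1 (imgMul pq.2 Y)) Set.univ}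

/-- The chain map `g(X) = qₙ⁻¹(pₙ(⋯(q₁⁻¹(p₁X))⋯))` associated to the list
`[(p₁,q₁),…,(pₙ,qₙ)]`. -/
def chainMap {P : Type*} [Monoid P] (l : List (P × P)) (X : Set P) : Set P :=
  l.foldl (fun Y pq => preMul pq.2 (imgMul pq.1 Y)) X

/-- `φ : Set P → ℝ` satisfies the ∨-condition if for all `X, Y ∈ J(P)` with
`X ∪ Y ∈ J(P)` one has `φ(X ∪ Y) = φ(X) + φ(Y) − φ(X ∩ Y)`. -/
def VeeCond {P : Type*} [Monoid P] (φ : Set P → ℝ) : Prop :=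
  ∀ X ∈ JP P, ∀ Y ∈ JP P, X ∪ Y ∈ JP P → φ (X ∪ Y) = φ X + φ Y - φ (X ∩ Y)

/-- A character: `φ(X) ∈ {0,1}` for `X ∈ J(P)`, `φ(P) = 1`, `φ(∅) = 0`, and
`φ(X ∩ Y) = φ(X)·φ(Y)` for all `X, Y ∈ J(P)`. -/
def IsCharacter {P : Type*} [Monoid P] (φ : Set P → ℝ) : Prop :=
  (∀ X ∈ JP P, φ X = 0 ∨ φ X = 1) ∧ φ (Set.univ : Set P) = 1 ∧
    φ (∅ : Set P) = 0 ∧ ∀ X ∈ JP P, ∀ Y ∈ JP P, φ (X ∩ Y) = φ X * φ Y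

theorem preMul_imgMul_mem_JP {P : Type*} [Monoid P] (p q : P) {X : Set P} (hX : X ∈ JP P) :
    preMul q (imgMul p X) ∈ JP P := by
  rcases hX with rfl | ⟨m, -, rfl⟩
  · exact Or.inl (by simp [preMul, imgMul])
  · exact Or.inr ⟨(q, p) :: m, List.cons_ne_nil _ _, rfl⟩

theorem chainMap_mem_JP {P : Type*} [Monoid P] (l : List (P × P)) {X : Set P} (hX : X ∈ JP P) :
    chainMap l X ∈ JP P := by
  induction l generalizing X with
  | nil => exact hX
  | cons a l ih => exact ih (preMul_imgMul_mem_JP a.1 a.2 hX)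

theorem chainMap_union {P : Type*} [Monoid P] (l : List (P × P)) (X Y : Set P) :
    chainMap l (X ∪ Y) = chainMap l X ∪ chainMap l Y := by
  induction l generalizing X Y with
  | nil => rfl
  | cons a l ih =>
    simpa only [chainMap, List.foldl_cons, preMul, imgMul, Set.image_union, Set.preimage_union]
      using ih (preMul a.2 (imgMul a.1 X)) (preMul a.2 (imgMul a.1 Y))

theorem chainMap_inter {P : Type*} [Monoid P] (hP : ∀ p x y : P, p * x = p * y → x = y)
    (l : List (P × P)) (X Y : Set P) :
    chainMap l (X ∩ Y) = chainMap l X ∩ chainMap l Y := by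
  induction l generalizing X Y with
  | nil => rfl
  | cons a l ih =>
    have ha : Function.Injective (fun x : P => a.1 * x) := fun x y h => hP a.1 x y h
    simpa only [chainMap, List.foldl_cons, preMul, imgMul, Set.image_inter ha, Set.preimage_inter]
      using ih (preMul a.2 (imgMul a.1 X)) (preMul a.2 (imgMul a.1 Y))

theorem stmt_3 {P : Type*} [Monoid P]
    (hP : ∀ p x y : P, p * x = p * y → x = y)
    (φ : Set P → ℝ) (hφ : VeeCond φ)
    (l : List (P × P)) (hl : l ≠ [])
    (X : Set P) (hX : X ∈ JP P) (Y : Set P) (hY : Y ∈ JP P)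
    (hXY : X ∪ Y ∈ JP P) :
    φ (chainMap l (X ∪ Y)) = φ (chainMap l X) + φ (chainMap l Y) - φ (chainMap l (X ∩ Y)) := by
  have hU := chainMap_mem_JP l hXY
  rw [chainMap_union] at hU ⊢
  rw [chainMap_inter hP]
  exact hφ _ (chainMap_mem_JP l hX) _ (chainMap_mem_JP l hY) hU
end

section
/- Let P be a left cancellative monoid, let Ê be the character space with the product topology, and let Ê_∨ := {φ ∈ Ê : φ satisfies the ∨-condition}. For X, Y ∈ J(P) with X ∪ Y ∈ J(P), let d_{X,Y} : Ê → ℝ be the continuous function d_{X,Y}(φ) := φ(X ∪ Y) + φ(X ∩ Y) − φ(X) − φ(Y). Then the topological closure in C(Ê, ℝ) (with the uniform norm) of the (non-unital) ℝ-subalgebra generated by the family {d_{X,Y} : X, Y ∈ J(P), X ∪ Y ∈ J(P)} equals the set of all continuous functions f : Ê → ℝ that vanish at every point of Ê_∨. -/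
open Set

/-- The character space `Ê`: characters vanishing outside `J(P)`, with the
subspace topology from the product topology on `Set P → ℝ`. -/
abbrev Ehat (P : Type*) [Monoid P] : Type _ :=
  {φ : Set P → ℝ // IsCharacter φ ∧ ∀ X ∉ JP P, φ X = 0}

/-- The continuous function `d_{X,Y}(φ) = φ(X ∪ Y) + φ(X ∩ Y) − φ(X) − φ(Y)` on `Ê`. -/
noncomputable def dFun {P : Type*} [Monoid P] (X Y : Set P) : C(Ehat P, ℝ) :=
  ⟨fun φ => φ.1 (X ∪ Y) + φ.1 (X ∩ Y) - φ.1 X - φ.1 Y, by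
    refine Continuous.sub (Continuous.sub (Continuous.add ?_ ?_) ?_) ?_ <;>
      exact (continuous_apply _).comp continuous_subtype_val⟩

theorem preMul_imgMul_inter_preMul_imgMul {P : Type*} [Monoid P]
    (hP : ∀ p x y : P, p * x = p * y → x = y) (p q : P) (T Y : Set P) :
    preMul p (imgMul q (T ∩ preMul q (imgMul p Y))) = preMul p (imgMul q T) ∩ Y := by
  unfold preMul imgMul
  have hp : Function.Injective (fun x : P => p * x) := fun x y h => hP p x y h
  rw [image_inter_preimage, preimage_inter, preimage_image_eq Y hp]

/-- Following a chain by its reversed chain restricts a set to the ideal of the chain. -/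
theorem foldr_append_reverse_swap {P : Type*} [Monoid P]
    (hP : ∀ p x y : P, p * x = p * y → x = y) (l : List (P × P)) (Y : Set P) :
    (l ++ (l.map Prod.swap).reverse).foldr (fun pq Y => preMul pq.1 (imgMul pq.2 Y)) Y =
      l.foldr (fun pq Y => preMul pq.1 (imgMul pq.2 Y)) univ ∩ Y := by
  induction l generalizing Y with
  | nil => simp
  | cons a t ih =>
    rw [List.map_cons, List.reverse_cons, List.cons_append, ← List.append_assoc,
      List.foldr_cons, List.foldr_append, ih]
    exact preMul_imgMul_inter_preMul_imgMul hP a.1 a.2 _ Y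

theorem inter_mem_JP {P : Type*} [Monoid P] (hP : ∀ p x y : P, p * x = p * y → x = y)
    {X Y : Set P} (hX : X ∈ JP P) (hY : Y ∈ JP P) : X ∩ Y ∈ JP P := by
  rcases hX with rfl | ⟨l, hl, rfl⟩
  · left; simp
  rcases hY with rfl | ⟨m, -, rfl⟩
  · left; simp
  right
  refine ⟨l ++ (l.map Prod.swap).reverse ++ m, by simp [hl], ?_⟩
  rw [List.foldr_append, foldr_append_reverse_swap hP]

/-- Evaluation of characters at a set, as a continuous function. -/
def evalFun {P : Type*} [Monoid P] (Z : Set P) : C(Ehat P, ℝ) :=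
  ⟨fun φ => φ.1 Z, (continuous_apply _).comp continuous_subtype_val⟩

theorem evalFun_mul_dFun {P : Type*} [Monoid P] (hP : ∀ p x y : P, p * x = p * y → x = y)
    {X Y Z : Set P} (hX : X ∈ JP P) (hY : Y ∈ JP P) (hXY : X ∪ Y ∈ JP P) (hZ : Z ∈ JP P) :
    evalFun Z * dFun X Y = dFun (X ∩ Z) (Y ∩ Z) := by
  ext φ
  have hm := φ.2.1.2.2.2
  simp only [ContinuousMap.mul_apply, evalFun, dFun, ContinuousMap.coe_mk]
  rw [← union_inter_distrib_right, ← inter_inter_distrib_right, hm _ hXY _ hZ,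
    hm _ (inter_mem_JP hP hX hY) _ hZ, hm _ hX _ hZ, hm _ hY _ hZ]
  ring

theorem separatesPoints_adjoin_evalFun (P : Type*) [Monoid P] :
    (Algebra.adjoin ℝ (evalFun '' JP P : Set C(Ehat P, ℝ))).SeparatesPoints := by
  intro φ ψ hne
  obtain ⟨Z, hZ⟩ : ∃ Z, φ.1 Z ≠ ψ.1 Z := by
    by_contra! h
    exact hne (Subtype.ext (funext h))
  have hZJ : Z ∈ JP P := by
    by_contra h
    exact hZ ((φ.2.2 Z h).trans (ψ.2.2 Z h).symm)
  exact ⟨_, ⟨evalFun Z, Algebra.subset_adjoin ⟨Z, hZJ, rfl⟩, rfl⟩, hZ⟩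

/-- The functions multiplying a non-unital subalgebra of `C(X, ℝ)` into itself. -/
def multiplierSubalgebra {X : Type*} [TopologicalSpace X]
    (A : NonUnitalSubalgebra ℝ C(X, ℝ)) : Subalgebra ℝ C(X, ℝ) where
  carrier := {g | ∀ a ∈ A, g * a ∈ A}
  mul_mem' {g h} hg hh a ha := by
    rw [mul_assoc]
    exact hg _ (hh a ha)
  add_mem' {g h} hg hh a ha := by
    rw [add_mul]
    exact add_mem (hg a ha) (hh a ha)
  algebraMap_mem' r a ha := by
    rw [← Algebra.smul_def]
    exact SMulMemClass.smul_mem r ha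

/-- A closed non-unital subalgebra of `C(X, ℝ)` stable under multiplication by a family of
functions separating the points of `X` is an ideal. -/
theorem mul_mem_of_separatesPoints {X : Type*} [TopologicalSpace X] [CompactSpace X]
    {A : NonUnitalSubalgebra ℝ C(X, ℝ)} (hA : IsClosed (A : Set C(X, ℝ))) {s : Set C(X, ℝ)}
    (hs : (Algebra.adjoin ℝ s).SeparatesPoints) (hmul : ∀ g ∈ s, ∀ a ∈ A, g * a ∈ A)
    (g : C(X, ℝ)) {a : C(X, ℝ)} (ha : a ∈ A) : g * a ∈ A := by
  have hclosed : IsClosed (multiplierSubalgebra A : Set C(X, ℝ)) := by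
    have : (multiplierSubalgebra A : Set C(X, ℝ)) = ⋂ a ∈ A, (fun g => g * a) ⁻¹' A := by
      ext g
      simp [multiplierSubalgebra]
    rw [this]
    exact isClosed_biInter fun a _ => hA.preimage (continuous_id.mul continuous_const)
  have hle : (Algebra.adjoin ℝ s).topologicalClosure ≤ multiplierSubalgebra A :=
    Subalgebra.topologicalClosure_minimal (Algebra.adjoin_le hmul) hclosed
  rw [ContinuousMap.subalgebra_topologicalClosure_eq_top_of_separatesPoints _ hs] at hle
  exact hle (Algebra.mem_top (x := g)) a ha

theorem stmt_13 {P : Type*} [Monoid P]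
    (hP : ∀ p x y : P, p * x = p * y → x = y)
    [CompactSpace (Ehat P)] :
    closure ((NonUnitalAlgebra.adjoin ℝ
        {d : C(Ehat P, ℝ) | ∃ X ∈ JP P, ∃ Y ∈ JP P, X ∪ Y ∈ JP P ∧ d = dFun X Y} :
          NonUnitalSubalgebra ℝ C(Ehat P, ℝ)) : Set C(Ehat P, ℝ)) =
      {f : C(Ehat P, ℝ) | ∀ φ : Ehat P, VeeCond φ.1 → f φ = 0} := by
  set D : Set C(Ehat P, ℝ) :=
    {d | ∃ X ∈ JP P, ∃ Y ∈ JP P, X ∪ Y ∈ JP P ∧ d = dFun X Y}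
  set A := NonUnitalAlgebra.adjoin ℝ D
  have hDA : D ⊆ A := NonUnitalAlgebra.subset_adjoin ℝ
  have hmul : ∀ g ∈ (evalFun '' JP P : Set C(Ehat P, ℝ)), ∀ a ∈ A, g * a ∈ A := by
    rintro _ ⟨Z, hZ, rfl⟩ a ha
    induction ha using NonUnitalAlgebra.adjoin_induction with
    | mem d hd =>
      obtain ⟨X, hX, Y, hY, hXY, rfl⟩ := hd
      rw [evalFun_mul_dFun hP hX hY hXY hZ]
      refine hDA ⟨_, inter_mem_JP hP hX hZ, _, inter_mem_JP hP hY hZ, ?_, rfl⟩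
      rw [← union_inter_distrib_right]
      exact inter_mem_JP hP hXY hZ
    | add a b _ _ ha hb => rw [mul_add]; exact add_mem ha hb
    | zero => rw [mul_zero]; exact zero_mem _
    | mul a b _ hb ha _ => rw [← mul_assoc]; exact mul_mem ha hb
    | smul r a _ ha => rw [mul_smul_comm]; exact SMulMemClass.smul_mem r ha
  have hmul' : ∀ g ∈ (evalFun '' JP P : Set C(Ehat P, ℝ)), ∀ a ∈ A.topologicalClosure,
      g * a ∈ A.topologicalClosure := fun g hg a ha =>
    map_mem_closure (continuous_const.mul continuous_id) ha (hmul g hg)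
  let I : Ideal C(Ehat P, ℝ) :=
    { carrier := A.topologicalClosure
      add_mem' := add_mem
      zero_mem' := zero_mem A.topologicalClosure
      smul_mem' := fun g _ ha => mul_mem_of_separatesPoints
        A.isClosed_topologicalClosure (separatesPoints_adjoin_evalFun P) hmul' g ha }
  have hI : IsClosed (I : Set C(Ehat P, ℝ)) := A.isClosed_topologicalClosure
  apply Subset.antisymm
  · refine closure_minimal (fun f hf φ hφ => ?_) ?_
    · induction hf using NonUnitalAlgebra.adjoin_induction with
      | mem d hd =>
        obtain ⟨X, hX, Y, hY, hXY, rfl⟩ := hd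
        simp [dFun, hφ X hX Y hY hXY]
      | add a b _ _ ha hb => simp [ha, hb]
      | zero => rfl
      | mul a b _ _ ha _ => simp [ha]
      | smul r a _ ha => simp [ha]
    · simp only [ofPred_forall]
      exact isClosed_iInter fun φ => isClosed_iInter fun _ =>
        isClosed_eq (continuous_eval_const φ) continuous_const
  · intro f hf
    change f ∈ I
    rw [← ContinuousMap.idealOfSet_ofIdeal_isClosed hI, ContinuousMap.mem_idealOfSet]
    intro φ hφ
    refine hf φ fun X hX Y hY hXY => ?_
    have h := ContinuousMap.notMem_setOfIdeal.mp hφ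
      (subset_closure (hDA ⟨X, hX, Y, hY, hXY, rfl⟩) : dFun X Y ∈ I)
    simp only [dFun, ContinuousMap.coe_mk] at h
    linarith
end
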